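/- If the switching interaction graph G_{σ(t)} is not uniformly jointly L-connected, then the system is not SISS with respect to ℒ(y(t)). More precisely, there is a time sequence 0 < T₁ < T₂ < … with G([T_{2κ−1}, T_{2κ})) not L-connected and T_{2κ} − T_{2κ−1} → ∞, and with the bounded inputs u_j(y,t) ≡ (1,…,1) for every leader j, w_i(t) ≡ 0 for every follower i, and initial conditions x_i(0) = 0 and y_j(0) = (1,…,1), some follower ı satisfies dist(x_ı(T_{2κ}), ℒ(y(T_{2κ}))) → +∞ as κ → ∞, so no class-𝒦𝓛/class-𝒦 pair (β, γ) can satisfy the SISS estimate. -/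

import Mathlib

open Metric Set Filter MeasureTheory

noncomputable section

/-- Data of the multi-agent system (5): the switching communication topology
(neighbor sets `Nb`, leader sets `Ld`), the weight functions `A` (= `a_{ij}`),
`B` (= `b_{ij}`), the dwell time `τD` and the weight bounds `aLo = a_*`,
`aHi = a^*`, `bLo = b_*`, together with Assumptions 1 and 2. -/
structure MASData (d n k : ℕ) where
  hn : 2 ≤ n
  hk : 1 ≤ k
  Nb : ℝ → Fin n → Finset (Fin n)
  Ld : ℝ → Fin n → Finset (Fin k)
  A : Fin n → Fin n → (Fin n → EuclideanSpace ℝ (Fin d)) →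
    (Fin k → EuclideanSpace ℝ (Fin d)) → ℝ → ℝ
  B : Fin n → Fin k → (Fin n → EuclideanSpace ℝ (Fin d)) →
    (Fin k → EuclideanSpace ℝ (Fin d)) → ℝ → ℝ
  τD : ℝ
  aLo : ℝ
  aHi : ℝ
  bLo : ℝ
  τD_pos : 0 < τD
  aLo_pos : 0 < aLo
  bLo_pos : 0 < bLo
  A_bdd : ∀ i j xv yv t, aLo ≤ A i j xv yv t ∧ A i j xv yv t ≤ aHi
  B_bdd : ∀ i j xv yv t, bLo ≤ B i j xv yv t
  A_cont : ∀ i j, Continuous fun p :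
    (Fin n → EuclideanSpace ℝ (Fin d)) × (Fin k → EuclideanSpace ℝ (Fin d)) × ℝ =>
    A i j p.1 p.2.1 p.2.2
  B_cont : ∀ i j, Continuous fun p :
    (Fin n → EuclideanSpace ℝ (Fin d)) × (Fin k → EuclideanSpace ℝ (Fin d)) × ℝ =>
    B i j p.1 p.2.1 p.2.2
  /-- The topology is piecewise constant with consecutive switching instants
  separated by at least the dwell time `τD` (Assumption 1). -/
  dwell : ∃ s : ℕ → ℝ, s 0 = 0 ∧ (∀ m : ℕ, s m + τD ≤ s (m + 1)) ∧
    ∀ m : ℕ, ∀ t₁ ∈ Set.Ico (s m) (s (m + 1)), ∀ t₂ ∈ Set.Ico (s m) (s (m + 1)),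
      Nb t₁ = Nb t₂ ∧ Ld t₁ = Ld t₂

namespace MASData

variable {d n k : ℕ}

/-- The arc relation of the communication graph at time `t`, on the node set
`Fin k ⊕ Fin n` (leaders ⊕ followers).  `arcAt t v v'` means there is an arc
leaving `v` and entering `v'`; there are no arcs from followers into leaders. -/
def arcAt (D : MASData d n k) (t : ℝ) (v v' : Fin k ⊕ Fin n) : Prop :=
  match v, v' with
  | Sum.inl j, Sum.inr i => j ∈ D.Ld t i
  | Sum.inr j, Sum.inr i => j ∈ D.Nb t i
  | _, _ => False

/-- Arc relation of the union graph over the set of times `T`. -/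
def arcOn (D : MASData d n k) (T : Set ℝ) (v v' : Fin k ⊕ Fin n) : Prop :=
  ∃ t ∈ T, D.arcAt t v v'

/-- The union graph over the set of times `T` is L-connected: every follower is
reachable from some leader by a directed path. -/
def LConnectedOn (D : MASData d n k) (T : Set ℝ) : Prop :=
  ∀ i : Fin n, ∃ j : Fin k, Relation.ReflTransGen (D.arcOn T) (Sum.inl j) (Sum.inr i)

/-- Uniformly jointly L-connected. -/
def UJLC (D : MASData d n k) : Prop :=
  ∃ T > (0:ℝ), ∀ t ≥ (0:ℝ), D.LConnectedOn (Set.Ico t (t + T))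

/-- Jointly L-connected. -/
def JLC (D : MASData d n k) : Prop :=
  ∀ t ≥ (0:ℝ), D.LConnectedOn (Set.Ici t)

end MASData

/-- A solution (trajectory) of system (5) together with its inputs: leader
controls `u`, disturbances `w`, follower states `x` and leader states `y`;
the dynamics hold in the sense of right derivatives for `t ≥ 0`, and the
(piecewise continuous) inputs are locally interval integrable along the
solution. -/
structure MASSol {d n k : ℕ} (D : MASData d n k) where
  x : ℝ → Fin n → EuclideanSpace ℝ (Fin d)
  y : ℝ → Fin k → EuclideanSpace ℝ (Fin d)
  u : Fin k → (Fin k → EuclideanSpace ℝ (Fin d)) → ℝ → EuclideanSpace ℝ (Fin d)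
  w : Fin n → ℝ → EuclideanSpace ℝ (Fin d)
  u_cont : ∀ j t, Continuous fun yv => u j yv t
  w_cont : ∀ i, Continuous (w i)
  x_cont : ∀ i, Continuous fun t => x t i
  y_cont : ∀ j, Continuous fun t => y t j
  dyn_y : ∀ (j : Fin k), ∀ t ≥ (0:ℝ),
    HasDerivWithinAt (fun s => y s j) (u j (y t) t) (Set.Ici t) t
  dyn_x : ∀ (i : Fin n), ∀ t ≥ (0:ℝ),
    HasDerivWithinAt (fun s => x s i)
      ((∑ j ∈ D.Nb t i, D.A i j (x t) (y t) t • (x t j - x t i)) +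
        (∑ j ∈ D.Ld t i, D.B i j (x t) (y t) t • (y t j - x t i)) + w i t)
      (Set.Ici t) t
  r_int : ∀ a b : ℝ, IntervalIntegrable (fun t => ⨆ j : Fin k, ‖u j (y t) t‖)
    MeasureTheory.volume a b
  q_int : ∀ a b : ℝ, IntervalIntegrable
    (fun t => (⨆ j : Fin k, ‖u j (y t) t‖) + ⨆ i : Fin n, ‖w i t‖)
    MeasureTheory.volume a b
  z_int : ∀ a b : ℝ, IntervalIntegrable
    (fun t => Real.sqrt ((∑ j : Fin k, ‖u j (y t) t‖ ^ 2) + ∑ i : Fin n, ‖w i t‖ ^ 2))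
    MeasureTheory.volume a b

namespace MASSol

variable {d n k : ℕ} {D : MASData d n k}

/-- The moving multi-leader set `ℒ(y(t))`: the convex hull of the leaders. -/
def Lset (sol : MASSol D) (t : ℝ) : Set (EuclideanSpace ℝ (Fin d)) :=
  convexHull ℝ (Set.range (sol.y t))

/-- `|x(t)|_{ℒ(y(t))}`: the maximal distance of the followers from `ℒ(y(t))`. -/
def distL (sol : MASSol D) (t : ℝ) : ℝ :=
  ⨆ i : Fin n, Metric.infDist (sol.x t i) (sol.Lset t)

/-- `r(t) = max_j |u_j(y(t),t)|`. -/
def rmax (sol : MASSol D) (t : ℝ) : ℝ := ⨆ j : Fin k, ‖sol.u j (sol.y t) t‖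

/-- `q(t) = max_j |u_j(y(t),t)| + max_i |w_i(t)|`. -/
def qmax (sol : MASSol D) (t : ℝ) : ℝ := sol.rmax t + ⨆ i : Fin n, ‖sol.w i t‖

/-- `|z(t)|`: the Euclidean norm of the combined input `z = (u, w)` at time `t`. -/
def znorm (sol : MASSol D) (t : ℝ) : ℝ :=
  Real.sqrt ((∑ j : Fin k, ‖sol.u j (sol.y t) t‖ ^ 2) + ∑ i : Fin n, ‖sol.w i t‖ ^ 2)

/-- `‖z‖_∞ = sup_{t ≥ 0} |z(t)|`. -/
def zsup (sol : MASSol D) : ℝ := sSup (sol.znorm '' Set.Ici 0)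

/-- The combined input `z` is (essentially) bounded, i.e. `z ∈ L_∞`. -/
def zBounded (sol : MASSol D) : Prop := BddAbove (sol.znorm '' Set.Ici 0)

end MASSol

/-- Class-𝒦 function on `[0,∞)`. -/
def IsClassK (γ : ℝ → ℝ) : Prop :=
  ContinuousOn γ (Set.Ici 0) ∧ StrictMonoOn γ (Set.Ici 0) ∧ γ 0 = 0

/-- Class-𝒦𝓛 function. -/
def IsClassKL (β : ℝ → ℝ → ℝ) : Prop :=
  (∀ t ≥ (0:ℝ), IsClassK fun s => β s t) ∧
  (∀ s ≥ (0:ℝ), AntitoneOn (fun t => β s t) (Set.Ici 0) ∧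
    Filter.Tendsto (fun t => β s t) Filter.atTop (nhds 0))

/-- System (5) is (generalized) set input-to-state stable with respect to
`ℒ(y(t))` with input `z`. -/
def MASData.SISS {d n k : ℕ} (D : MASData d n k) : Prop :=
  ∃ β γ, IsClassKL β ∧ IsClassK γ ∧
    ∀ sol : MASSol D, sol.zBounded →
      ∀ t ≥ (0:ℝ), sol.distL t ≤ β (sol.distL 0) t + γ sol.zsup

/-- System (5) is (generalized) set integral-input-to-state stable with respect
to `ℒ(y(t))`. -/
def MASData.SiISS {d n k : ℕ} (D : MASData d n k) : Prop :=
  ∃ β γ, IsClassKL β ∧ IsClassK γ ∧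
    ∀ sol : MASSol D, ∀ t ≥ (0:ℝ),
      sol.distL t ≤ β (sol.distL 0) t + ∫ s in (0:ℝ)..t, γ (sol.znorm s)

/-- The upper Dini derivative `D⁺h(t) = limsup_{s→0⁺} (h(t+s) − h(t))/s`. -/
def upperDini (h : ℝ → ℝ) (t : ℝ) : ℝ :=
  Filter.limsup (fun s => (h (t + s) - h t) / s) (nhdsWithin 0 (Set.Ioi 0))

/-- A finite family of functions stays nonpositive if each member has a negative right derivative
whenever it touches zero while the whole family is nonpositive. -/
lemma forall_nonpos_of_right_deriv_neg {ι : Type*} [Finite ι] {g : ι → ℝ → ℝ} {g' : ι → ℝ → ℝ}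
    {a b : ℝ} (hcont : ∀ i, ContinuousOn (g i) (Icc a b)) (ha : ∀ i, g i a ≤ 0)
    (hderiv : ∀ i, ∀ t ∈ Ico a b, HasDerivWithinAt (g i) (g' i t) (Ici t) t)
    (hneg : ∀ i, ∀ t ∈ Ico a b, (∀ j, g j t ≤ 0) → g i t = 0 → g' i t < 0) :
    ∀ t ∈ Icc a b, ∀ i, g i t ≤ 0 := by
  have hclosed : IsClosed ({t | ∀ i, g i t ≤ 0} ∩ Icc a b) := by
    have heq : {t | ∀ i, g i t ≤ 0} ∩ Icc a b = Icc a b ∩ ⋂ i, (Icc a b ∩ g i ⁻¹' Iic 0) := by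
      ext t
      simp only [mem_inter_iff, mem_ofPred_eq, mem_iInter, mem_preimage, mem_Iic]
      exact ⟨fun h => ⟨h.2, fun i => ⟨h.2, h.1 i⟩⟩, fun h => ⟨fun i => (h.2 i).2, h.1⟩⟩
    rw [heq]
    exact isClosed_Icc.inter (isClosed_iInter fun i =>
      (hcont i).preimage_isClosed_of_isClosed isClosed_Icc isClosed_Iic)
  refine hclosed.Icc_subset_of_forall_exists_gt ha fun t ht y hy => ?_
  have hev : ∀ᶠ s in nhdsWithin t (Ioi t), ∀ i, g i s ≤ 0 := by
    refine eventually_all.2 fun i => ?_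
    have hd := (hderiv i t ht.2).mono Ioi_subset_Ici_self
    rcases (ht.1 i).lt_or_eq with h | h
    · exact (hd.continuousWithinAt.eventually (gt_mem_nhds h)).mono fun s hs => le_of_lt hs
    · have hslope := (hasDerivWithinAt_iff_tendsto_slope' (lt_irrefl t)).1 hd
      filter_upwards [hslope.eventually (gt_mem_nhds (hneg i t ht.2 ht.1 h)),
        self_mem_nhdsWithin] with s hs hts
      rw [slope_def_field, h, sub_zero, div_neg_iff] at hs
      have : 0 < s - t := sub_pos.2 hts
      rcases hs with hs | hs <;> linarith [hs.1, hs.2]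
  obtain ⟨s, hs, hs'⟩ := (hev.and (Ioc_mem_nhdsGT hy)).exists
  exact ⟨s, hs, hs'⟩

namespace MASData

variable {d n k : ℕ}

/-- Follower `i` is reachable from some leader in the union graph over `T`. -/
def ReachableOn (D : MASData d n k) (T : Set ℝ) (i : Fin n) : Prop :=
  ∃ j : Fin k, Relation.ReflTransGen (D.arcOn T) (Sum.inl j) (Sum.inr i)

lemma ReachableOn.mono {D : MASData d n k} {S T : Set ℝ} (hST : S ⊆ T) {i : Fin n}
    (h : D.ReachableOn S i) : D.ReachableOn T i := by
  obtain ⟨j, hj⟩ := h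
  exact ⟨j, Relation.ReflTransGen.mono (fun _ _ ⟨t, ht, harc⟩ => ⟨t, hST ht, harc⟩) _ _ hj⟩

lemma reachableOn_of_mem_Ld {D : MASData d n k} {T : Set ℝ} {t : ℝ} (ht : t ∈ T) {i : Fin n}
    {j : Fin k} (hj : j ∈ D.Ld t i) : D.ReachableOn T i :=
  ⟨j, .single ⟨t, ht, hj⟩⟩

lemma ReachableOn.of_mem_Nb {D : MASData d n k} {T : Set ℝ} {t : ℝ} (ht : t ∈ T) {i j : Fin n}
    (hj : j ∈ D.Nb t i) (h : D.ReachableOn T j) : D.ReachableOn T i := by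
  obtain ⟨l, hl⟩ := h
  exact ⟨l, hl.tail ⟨t, ht, hj⟩⟩

/-- Without uniform joint L-connectivity, a single follower is unreachable over arbitrarily long
intervals starting arbitrarily late. -/
lemma exists_not_reachableOn {D : MASData d n k} (h : ¬ D.UJLC) :
    ∃ i, ∀ M > (0 : ℝ), ∃ a > M, ¬ D.ReachableOn (Ico a (a + M)) i := by
  by_contra! hcon
  choose M hM hreach using hcon
  have hn : (0 : ℕ) < n := by have := D.hn; omega
  have hsum : ∀ i, M i ≤ ∑ j, M j := fun i =>
    Finset.single_le_sum (fun j _ => (hM j).le) (Finset.mem_univ i)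
  have hpos : 0 < ∑ j, M j := (hM ⟨0, hn⟩).trans_le (hsum _)
  refine h ⟨3 * ∑ j, M j, by positivity, fun t ht i => ?_⟩
  have hi := hsum i
  have hMi := hM i
  exact (hreach i (t + 2 * M i) (by linarith)).mono
    (Ico_subset_Ico (by linarith) (by linarith))

end MASData

namespace MASSol

variable {d n k : ℕ} {D : MASData d n k}

lemma hasDerivWithinAt_y_apply (sol : MASSol D) (j : Fin k) (c : Fin d) {t : ℝ} (ht : 0 ≤ t) :
    HasDerivWithinAt (fun s => sol.y s j c) (sol.u j (sol.y t) t c) (Ici t) t :=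
  (EuclideanSpace.proj (𝕜 := ℝ) c).hasFDerivAt.comp_hasDerivWithinAt t (sol.dyn_y j t ht)

lemma hasDerivWithinAt_x_apply (sol : MASSol D) (i : Fin n) (c : Fin d) {t : ℝ} (ht : 0 ≤ t) :
    HasDerivWithinAt (fun s => sol.x s i c)
      ((∑ j ∈ D.Nb t i, D.A i j (sol.x t) (sol.y t) t * (sol.x t j c - sol.x t i c)) +
        (∑ j ∈ D.Ld t i, D.B i j (sol.x t) (sol.y t) t * (sol.y t j c - sol.x t i c)) +
        sol.w i t c) (Ici t) t := by
  have h := (EuclideanSpace.proj (𝕜 := ℝ) c).hasFDerivAt.comp_hasDerivWithinAt t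
    (sol.dyn_x i t ht)
  simp only [map_add, map_sum, map_smul, map_sub, EuclideanSpace.coe_proj, smul_eq_mul] at h
  exact h

lemma continuous_x_apply (sol : MASSol D) (i : Fin n) (c : Fin d) :
    Continuous fun t => sol.x t i c :=
  (EuclideanSpace.proj (𝕜 := ℝ) c).continuous.comp (sol.x_cont i)

lemma continuous_y_apply (sol : MASSol D) (j : Fin k) (c : Fin d) :
    Continuous fun t => sol.y t j c :=
  (EuclideanSpace.proj (𝕜 := ℝ) c).continuous.comp (sol.y_cont j)

lemma y_apply_eq (sol : MASSol D) {c : Fin d} (hu : ∀ j yv t, sol.u j yv t c = 1)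
    (hy0 : ∀ j, sol.y 0 j c = 1) {t : ℝ} (ht : 0 ≤ t) (j : Fin k) : sol.y t j c = 1 + t := by
  have h := constant_of_has_deriv_right_zero (f := fun s => sol.y s j c - s) (a := 0) (b := t)
    ((sol.continuous_y_apply j c).sub continuous_id).continuousOn
    (fun s hs => by
      have hderiv := (sol.hasDerivWithinAt_y_apply j c hs.1).sub (hasDerivWithinAt_id s (Ici s))
      rw [hu, sub_self] at hderiv
      exact hderiv) t ⟨ht, le_rfl⟩
  simp only [hy0] at h
  linarith

lemma x_apply_le (sol : MASSol D) {c : Fin d} (hy : ∀ t ≥ 0, ∀ j, sol.y t j c = 1 + t)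
    (hw : ∀ i t, sol.w i t c = 0) (hx0 : ∀ i, sol.x 0 i c = 0) {t : ℝ} (ht : 0 ≤ t) (i : Fin n) :
    sol.x t i c ≤ 1 + t := by
  have h := forall_nonpos_of_right_deriv_neg (g := fun i s => sol.x s i c - (1 + s))
    (a := 0) (b := t)
    (fun i => ((sol.continuous_x_apply i c).sub (continuous_const.add continuous_id)).continuousOn)
    (fun i => by simp [hx0])
    (fun i s hs => (sol.hasDerivWithinAt_x_apply i c hs.1).sub
      ((hasDerivWithinAt_id s (Ici s)).const_add 1))
    (fun i s hs hall hi => by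
      have hA : ∑ j ∈ D.Nb s i, D.A i j (sol.x s) (sol.y s) s * (sol.x s j c - sol.x s i c) ≤ 0 :=
        Finset.sum_nonpos fun j _ => mul_nonpos_of_nonneg_of_nonpos
          (D.aLo_pos.le.trans (D.A_bdd ..).1) (by linarith [hall j])
      have hB : ∑ j ∈ D.Ld s i, D.B i j (sol.x s) (sol.y s) s * (sol.y s j c - sol.x s i c) = 0 :=
        Finset.sum_eq_zero fun j _ => by rw [hy s hs.1 j, ← neg_sub, hi]; simp
      rw [hw, hB]
      linarith)
    t ⟨ht, le_rfl⟩ i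
  linarith

/-- A follower cut off from all leaders over `[a, b)` lags behind them: its coordinate grows by at
most half of the elapsed time. -/
lemma x_apply_le_of_not_reachableOn (sol : MASSol D) {c : Fin d} (hw : ∀ i t, sol.w i t c = 0)
    {a b C : ℝ} (ha : 0 ≤ a) (hab : a ≤ b) (hC : ∀ i, sol.x a i c ≤ C) {i : Fin n}
    (hi : ¬ D.ReachableOn (Ico a b) i) : sol.x b i c ≤ C + (b - a) / 2 := by
  have h := forall_nonpos_of_right_deriv_neg
    (ι := {i : Fin n // ¬ D.ReachableOn (Ico a b) i})
    (g := fun i s => sol.x s i c - (C + (s - a) / 2)) (a := a) (b := b)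
    (fun i => ((sol.continuous_x_apply i c).sub (by fun_prop)).continuousOn)
    (fun i => by simpa using hC i)
    (fun i s hs => (sol.hasDerivWithinAt_x_apply i c (ha.trans hs.1)).sub
      ((((hasDerivWithinAt_id s (Ici s)).sub_const a).div_const 2).const_add C))
    (fun i s hs hall hi' => by
      have hA : ∑ j ∈ D.Nb s i, D.A i j (sol.x s) (sol.y s) s * (sol.x s j c - sol.x s i c) ≤ 0 :=
        Finset.sum_nonpos fun j hj => mul_nonpos_of_nonneg_of_nonpos
          (D.aLo_pos.le.trans (D.A_bdd ..).1)
          (by linarith [hall ⟨j, fun hr => i.2 (hr.of_mem_Nb hs hj)⟩])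
      have hB : D.Ld s i = ∅ :=
        Finset.eq_empty_of_forall_notMem fun j hj => i.2 (MASData.reachableOn_of_mem_Ld hs hj)
      rw [hw, hB, Finset.sum_empty]
      linarith)
    b ⟨hab, le_rfl⟩ ⟨i, hi⟩
  linarith

lemma sub_le_infDist_Lset (sol : MASSol D) {c : Fin d} {t v : ℝ} (hy : ∀ j, sol.y t j c = v)
    (p : EuclideanSpace ℝ (Fin d)) : v - p c ≤ infDist p (sol.Lset t) := by
  have hne : (sol.Lset t).Nonempty :=
    (range_nonempty_iff_nonempty.2 ⟨⟨0, D.hk⟩⟩ : (range (sol.y t)).Nonempty).mono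
      (subset_convexHull ℝ _)
  refine (le_infDist hne).2 fun q hq => ?_
  have hsub : sol.Lset t ⊆ EuclideanSpace.proj (𝕜 := ℝ) c ⁻¹' {v} :=
    convexHull_min (by rintro _ ⟨j, rfl⟩; exact hy j)
      ((convex_singleton v).linear_preimage (EuclideanSpace.proj (𝕜 := ℝ) c).toLinearMap)
  have hqv : q c = v := hsub hq
  have hnorm : ‖(p - q) c‖ ≤ ‖p - q‖ := PiLp.norm_apply_le (p - q) c
  rw [dist_eq_norm]
  rw [PiLp.sub_apply, hqv, Real.norm_eq_abs, abs_sub_comm] at hnorm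
  exact (le_abs_self _).trans hnorm

lemma infDist_le_distL (sol : MASSol D) (t : ℝ) (i : Fin n) :
    infDist (sol.x t i) (sol.Lset t) ≤ sol.distL t :=
  le_ciSup (f := fun i => infDist (sol.x t i) (sol.Lset t)) (finite_range _).bddAbove i

lemma distL_nonneg (sol : MASSol D) (t : ℝ) : 0 ≤ sol.distL t :=
  Real.iSup_nonneg fun _ => infDist_nonneg

/-- No class-𝒦𝓛 bound plus a constant dominates `distL` if a follower's distance to the leader set
diverges along some sequence of nonnegative times. -/
lemma not_forall_distL_le (sol : MASSol D) {s : ℕ → ℝ} (hs : ∀ m, 0 ≤ s m) {i : Fin n}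
    (hi : Tendsto (fun m => infDist (sol.x (s m) i) (sol.Lset (s m))) atTop atTop)
    {β : ℝ → ℝ → ℝ} (hβ : IsClassKL β) (C : ℝ) :
    ¬ ∀ t ≥ (0 : ℝ), sol.distL t ≤ β (sol.distL 0) t + C := by
  intro h
  obtain ⟨m, hm⟩ := (hi.eventually_gt_atTop (β (sol.distL 0) 0 + C)).exists
  have hanti := (hβ.2 _ (sol.distL_nonneg 0)).1 self_mem_Ici (hs m) (hs m)
  have hle := h (s m) (hs m)
  have := sol.infDist_le_distL (s m) i
  simp only at hanti
  linarith

end MASSol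

/-- If long windows `[a, a + M)` with property `P` start arbitrarily late, they can be interlaced
into a strictly increasing sequence of endpoints with diverging window lengths. -/
lemma exists_strictMono_windows {P : ℝ → ℝ → Prop} (h : ∀ M > (0 : ℝ), ∃ a > M, P a (a + M)) :
    ∃ T : ℕ → ℝ, StrictMono T ∧ 0 ≤ T 0 ∧ (∀ κ : ℕ, 1 ≤ κ → P (T (2 * κ - 1)) (T (2 * κ))) ∧
      Tendsto (fun κ : ℕ => T (2 * κ) - T (2 * κ - 1)) atTop atTop := by
  choose! f hf hP using h
  let E : ℕ → ℝ := fun m => Nat.rec 0 (fun κ e => f (e + κ + 1) + (e + κ + 1)) m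
  have hE : ∀ κ, E (κ + 1) = f (E κ + κ + 1) + (E κ + κ + 1) := fun _ => rfl
  have hpos : ∀ κ, 0 ≤ E κ := by
    intro κ
    induction κ with
    | zero => exact le_rfl
    | succ κ ih =>
      have hM : (0 : ℝ) < E κ + κ + 1 := by positivity
      rw [hE]
      linarith [hf _ hM]
  have hM : ∀ κ : ℕ, (0 : ℝ) < E κ + κ + 1 := fun κ => by have := hpos κ; positivity
  let T : ℕ → ℝ := fun m => if Even m then E (m / 2) else f (E (m / 2) + (m / 2 : ℕ) + 1)
  have hTeven : ∀ κ, T (2 * κ) = E κ := fun κ => by simp [T]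
  have hTodd : ∀ κ, T (2 * κ + 1) = f (E κ + κ + 1) := fun κ => by
    have hdiv : (2 * κ + 1) / 2 = κ := by omega
    simp [T, hdiv]
  refine ⟨T, strictMono_nat_of_lt_succ fun m => ?_, (hTeven 0).ge, fun κ hκ => ?_, ?_⟩
  · obtain ⟨κ, rfl | rfl⟩ := Nat.even_or_odd' m
    · rw [hTeven, hTodd]
      have : (0 : ℝ) ≤ κ := κ.cast_nonneg
      linarith [hf _ (hM κ)]
    · rw [hTodd, show 2 * κ + 1 + 1 = 2 * (κ + 1) by ring, hTeven, hE]
      linarith [hM κ]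
  · obtain ⟨κ, rfl⟩ := Nat.exists_eq_add_of_le' hκ
    rw [show 2 * (κ + 1) - 1 = 2 * κ + 1 by omega, hTeven, hTodd, hE]
    exact hP _ (hM κ)
  · rw [← tendsto_add_atTop_iff_nat 1]
    refine tendsto_atTop_mono (fun κ => ?_) (tendsto_natCast_atTop_atTop (R := ℝ))
    rw [show 2 * (κ + 1) - 1 = 2 * κ + 1 by omega, hTeven, hTodd, hE]
    linarith [hpos κ]

/-- **Theorem 5 ("only if" part).**  If the switching interaction graph is not
UJLC, then the system is not SISS: there is a time sequence `0 < T₁ < T₂ < …`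
with `G([T_{2κ−1}, T_{2κ}))` not L-connected and `T_{2κ} − T_{2κ−1} → ∞`, and
for the bounded inputs `u_j ≡ (1,…,1)`, `w_i ≡ 0` and initial conditions
`x_i(0) = 0`, `y_j(0) = (1,…,1)`, some follower's distance to `ℒ(y(t))`
diverges along `T_{2κ}`, so no class-𝒦𝓛/class-𝒦 pair satisfies the SISS
estimate. -/
theorem not_ujlc_implies_not_SISS {d n k : ℕ} (hd : 0 < d)
    (D : MASData d n k) (hnot : ¬ D.UJLC) :
    ∃ T : ℕ → ℝ, StrictMono T ∧ 0 < T 1 ∧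
      (∀ κ : ℕ, 1 ≤ κ → ¬ D.LConnectedOn (Set.Ico (T (2 * κ - 1)) (T (2 * κ)))) ∧
      Filter.Tendsto (fun κ : ℕ => T (2 * κ) - T (2 * κ - 1)) Filter.atTop Filter.atTop ∧
      ∀ sol : MASSol D,
        (∀ j yv t, ∀ c : Fin d, sol.u j yv t c = 1) →
        (∀ i t, sol.w i t = 0) →
        (∀ i, sol.x 0 i = 0) →
        (∀ j, ∀ c : Fin d, sol.y 0 j c = 1) →
        (∃ i₀ : Fin n, Filter.Tendsto
            (fun κ : ℕ => Metric.infDist (sol.x (T (2 * κ)) i₀) (sol.Lset (T (2 * κ))))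
            Filter.atTop Filter.atTop) ∧
        ∀ β γ, IsClassKL β → IsClassK γ →
          ¬ ∀ t ≥ (0:ℝ), sol.distL t ≤ β (sol.distL 0) t + γ sol.zsup := by
  obtain ⟨i₀, hi₀⟩ := D.exists_not_reachableOn hnot
  obtain ⟨T, hmono, hT0, hwin, hlen⟩ :=
    exists_strictMono_windows (P := fun a b => ¬ D.ReachableOn (Ico a b) i₀) hi₀
  have hTnn : ∀ m, 0 ≤ T m := fun m => hT0.trans (hmono.monotone m.zero_le)
  refine ⟨T, hmono, hT0.trans_lt (hmono one_pos), fun κ hκ h => hwin κ hκ (h i₀), hlen, ?_⟩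
  intro sol hu hw hx0 hy0
  let c : Fin d := ⟨0, hd⟩
  have hy : ∀ t ≥ 0, ∀ j, sol.y t j c = 1 + t := fun t ht j =>
    sol.y_apply_eq (fun j yv t => hu j yv t c) (fun j => hy0 j c) ht j
  have hwc : ∀ i t, sol.w i t c = 0 := fun i t => by rw [hw]; rfl
  have hxc : ∀ i, sol.x 0 i c = 0 := fun i => by simp [hx0]
  have hdiv : Tendsto (fun κ : ℕ => infDist (sol.x (T (2 * κ)) i₀) (sol.Lset (T (2 * κ))))
      atTop atTop := by
    refine tendsto_atTop_mono' _ ?_ (hlen.atTop_div_const two_pos)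
    filter_upwards [eventually_ge_atTop 1] with κ hκ
    have hlag := sol.x_apply_le_of_not_reachableOn hwc (hTnn (2 * κ - 1))
      (hmono.monotone (Nat.sub_le _ _)) (fun i => sol.x_apply_le hy hwc hxc (hTnn _) i)
      (hwin κ hκ)
    have hdist := sol.sub_le_infDist_Lset (hy _ (hTnn (2 * κ))) (sol.x (T (2 * κ)) i₀)
    linarith
  exact ⟨⟨i₀, hdiv⟩, fun β γ hβ _ =>
    sol.not_forall_distL_le (fun κ => hTnn (2 * κ)) hdiv hβ (γ sol.zsup)⟩
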